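/- arXiv:2111.11109 — 3 statements merged into one kernel-verified Lean document; each statement's English description precedes it below -/
import Mathlib

section
/- Let 𝒜 be a locally-Gorenstein Λ-order in A. Then the functor M ↦ Hom_𝒜(M,𝒜) is exact on the category of finitely generated Λ-torsion-free 𝒜-modules: for every short exact sequence 0 → M' → M → M'' → 0 of finitely generated Λ-torsion-free left 𝒜-modules, the induced sequence 0 → Hom_𝒜(M'',𝒜) → Hom_𝒜(M,𝒜) → Hom_𝒜(M',𝒜) → 0 is exact. Equivalently, Ext¹_𝒜(N,𝒜) = 0 for every finitely generated Λ-torsion-free 𝒜-module N. -/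
/-!
Statement 0.  Let `Λ` be a Dedekind domain with fraction field `F`, `A` a finite-dimensional
separable-enough `F`-algebra and `𝒜` a `Λ`-order in `A`.  The order `𝒜` is
*locally-Gorenstein* if there is a `Λ`-linear anti-involution `ι` of `𝒜` such that for
every prime ideal `p` of `Λ` the localization at `p` of `Hom_Λ(𝒜, Λ)` is a free rank-one
`𝒜_(p)`-module for the action `(a • θ)(a') = θ (ι a * a')`; we encode this by asking that
for some `θ` the `𝒜`-equivariant map `a ↦ a • θ` from `𝒜` to `Hom_Λ(𝒜, Λ)` becomes
bijective after localization at `p`.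

Theorem: if `𝒜` is locally-Gorenstein, then the functor `M ↦ Hom_𝒜(M, 𝒜)` is exact on
finitely generated `Λ`-torsion-free `𝒜`-modules: for every short exact sequence
`0 → M' → M → M'' → 0` of such modules, the induced sequence
`0 → Hom_𝒜(M'', 𝒜) → Hom_𝒜(M, 𝒜) → Hom_𝒜(M', 𝒜) → 0` is exact.
-/

noncomputable section

variable (Λ : Type) [CommRing Λ] [IsDomain Λ] [IsDedekindDomain Λ]
variable (F : Type) [Field F] [Algebra Λ F] [IsFractionRing Λ F]
variable (A : Type) [Ring A] [Algebra F A] [FiniteDimensional F A]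
  [Algebra Λ A] [IsScalarTower Λ F A]
variable (𝒜 : Subalgebra Λ A)

/-- `ι` is a `Λ`-linear anti-involution of `𝒜`. -/
def IsAntiInvolution (ι : ↥𝒜 →ₗ[Λ] ↥𝒜) : Prop :=
  (∀ x y : ↥𝒜, ι (x * y) = ι y * ι x) ∧ ∀ x : ↥𝒜, ι (ι x) = x

/-- The `Λ`-linear map `𝒜 → Hom_Λ(𝒜, Λ)`, `a ↦ a • θ`, where
`(a • θ) (a') = θ (ι a * a')` is the `ι`-twisted left `𝒜`-action on the dual. -/
def dualActionMap (ι : ↥𝒜 →ₗ[Λ] ↥𝒜) (θ : Module.Dual Λ ↥𝒜) :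
    ↥𝒜 →ₗ[Λ] Module.Dual Λ ↥𝒜 :=
  (LinearMap.llcomp Λ ↥𝒜 ↥𝒜 Λ θ).comp ((LinearMap.mul Λ ↥𝒜).comp ι)

/-- The `Λ`-order `𝒜` is locally-Gorenstein: there is a `Λ`-linear anti-involution `ι`
of `𝒜` such that for every prime ideal `p` of `Λ`, the localization at `p` of
`Hom_Λ(𝒜, Λ)` is a free rank-one module over the localization of `𝒜` at `p`, with
respect to the `ι`-twisted action. -/
def IsLocallyGorenstein : Prop :=
  ∃ ι : ↥𝒜 →ₗ[Λ] ↥𝒜, IsAntiInvolution Λ A 𝒜 ι ∧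
    ∀ (p : Ideal Λ) [p.IsPrime],
      ∃ θ : Module.Dual Λ ↥𝒜,
        Function.Bijective (LocalizedModule.map p.primeCompl (dualActionMap Λ A 𝒜 ι θ))

theorem aux_projective {R N : Type} [CommRing R] [IsDomain R] [IsDedekindDomain R]
    [AddCommGroup N] [Module R N] [Module.Finite R N] [NoZeroSMulDivisors R N] :
    Module.Projective R N := by
  have : Module.IsTorsionFree R N := inferInstance
  have : Module.FinitePresentation R N := Module.finitePresentation_of_finite R N
  apply Module.projective_of_localization_maximal
  intro I hI
  have : Module.Free (Localization.AtPrime I) (LocalizedModule I.primeCompl N) :=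
    Module.free_of_flat_of_isLocalRing
  infer_instance

theorem aux_local {R N P : Type} [CommRing R] [IsDomain R]
    [AddCommGroup N] [Module R N] [NoZeroSMulDivisors R N]
    [AddCommGroup P] [Module R P] [Module.Finite R P]
    (p : Ideal R) [p.IsPrime] (D : N →ₗ[R] P)
    (hD : Function.Bijective (LocalizedModule.map p.primeCompl D)) :
    Function.Injective D ∧ ∃ t : R, t ∉ p ∧ ∀ y, ∃ x, D x = t • y := by
  classical
  constructor
  · rw [injective_iff_map_eq_zero]
    intro a ha
    have h1 : LocalizedModule.map p.primeCompl D (LocalizedModule.mk a 1) = 0 := by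
      rw [LocalizedModule.map_mk, ha, LocalizedModule.zero_mk]
    have h2 : LocalizedModule.mk a (1 : p.primeCompl) = 0 :=
      hD.1 (by rw [h1, map_zero])
    rw [← LocalizedModule.zero_mk (1 : p.primeCompl), LocalizedModule.mk_eq] at h2
    obtain ⟨u, hu⟩ := h2
    simp only [one_smul, smul_zero] at hu
    rcases smul_eq_zero.mp (show (u : R) • a = 0 from hu) with h | h
    · exact absurd (h ▸ p.zero_mem) u.2
    · exact h
  · have key : ∀ y : P, ∃ t : R, t ∉ p ∧ t • y ∈ LinearMap.range D := by
      intro y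
      obtain ⟨z, hz⟩ := hD.2 (LocalizedModule.mk y 1)
      induction z using LocalizedModule.induction_on with
      | h a s =>
        rw [LocalizedModule.map_mk, LocalizedModule.mk_eq] at hz
        obtain ⟨u, hu⟩ := hz
        refine ⟨u * s, (u * s).2, (u : R) • a, ?_⟩
        rw [map_smul, mul_smul]
        rw [one_smul] at hu
        exact hu
    choose t ht htm using key
    obtain ⟨S, hS⟩ := (Module.Finite.fg_top : (⊤ : Submodule R P).FG)
    refine ⟨∏ y ∈ S, t y, ?_, ?_⟩
    · intro h
      obtain ⟨y, -, hy⟩ := (Ideal.IsPrime.prod_mem_iff).mp h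
      exact ht y hy
    · intro y
      have hy : y ∈ Submodule.span R (S : Set P) := hS ▸ Submodule.mem_top
      change (∏ y ∈ S, t y) • y ∈ LinearMap.range D
      induction hy using Submodule.span_induction with
      | mem x hx =>
        rw [← Finset.prod_erase_mul S t hx, mul_smul]
        exact Submodule.smul_mem _ _ (htm x)
      | zero => rw [smul_zero]; exact Submodule.zero_mem _
      | add x y _ _ hx hy => rw [smul_add]; exact Submodule.add_mem _ hx hy
      | smul a x _ hx => rw [smul_comm]; exact Submodule.smul_mem _ _ hx

theorem aux_extend {R N' N N'' : Type} [CommRing R]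
    [AddCommGroup N'] [Module R N'] [AddCommGroup N] [Module R N]
    [AddCommGroup N''] [Module R N''] [Module.Projective R N'']
    (f : N' →ₗ[R] N) (g : N →ₗ[R] N'') (hf : Function.Injective f)
    (hg : Function.Surjective g) (hfg : ∀ x, g x = 0 → ∃ y, f y = x)
    (hgf : ∀ y, g (f y) = 0)
    (l : N' →ₗ[R] R) : ∃ L : N →ₗ[R] R, ∀ y, L (f y) = l y := by
  obtain ⟨σ, hσ⟩ := Module.projective_lifting_property g LinearMap.id hg
  have hσ' : ∀ x, g (σ x) = x := fun x => LinearMap.congr_fun hσ x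
  have : ∀ x, ∃ y, f y = x - σ (g x) := fun x => hfg _ (by rw [map_sub, hσ', sub_self])
  choose r hr using this
  let ρ : N →ₗ[R] N' :=
    { toFun := r
      map_add' := fun x y => hf (by simp only [map_add, hr]; abel)
      map_smul' := fun a x => hf (by simp [hr, smul_sub]) }
  refine ⟨l.comp ρ, fun y => ?_⟩
  change l (r (f y)) = l y
  congr 1
  exact hf (by rw [hr, hgf, map_zero, sub_zero])

/-- If `𝒜` is a locally-Gorenstein `Λ`-order, then `Hom_𝒜(-, 𝒜)` is exact on finitely
generated `Λ`-torsion-free `𝒜`-modules. -/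
theorem locallyGorenstein_hom_exact
    [Module.Finite Λ ↥𝒜] (hspan : Submodule.span F (𝒜 : Set A) = ⊤)
    (hLG : IsLocallyGorenstein Λ A 𝒜)
    (M' M M'' : Type)
    [AddCommGroup M'] [Module ↥𝒜 M'] [Module Λ M'] [IsScalarTower Λ ↥𝒜 M']
    [Module.Finite ↥𝒜 M'] [NoZeroSMulDivisors Λ M']
    [AddCommGroup M] [Module ↥𝒜 M] [Module Λ M] [IsScalarTower Λ ↥𝒜 M]
    [Module.Finite ↥𝒜 M] [NoZeroSMulDivisors Λ M]
    [AddCommGroup M''] [Module ↥𝒜 M''] [Module Λ M''] [IsScalarTower Λ ↥𝒜 M'']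
    [Module.Finite ↥𝒜 M''] [NoZeroSMulDivisors Λ M'']
    (f : M' →ₗ[↥𝒜] M) (g : M →ₗ[↥𝒜] M'')
    (hf : Function.Injective f) (hg : Function.Surjective g)
    (hfg : LinearMap.range f = LinearMap.ker g) :
    Function.Injective (fun φ : M'' →ₗ[↥𝒜] ↥𝒜 => φ.comp g) ∧
      (∀ ψ : M →ₗ[↥𝒜] ↥𝒜,
          ψ.comp f = 0 ↔ ∃ φ : M'' →ₗ[↥𝒜] ↥𝒜, ψ = φ.comp g) ∧
        Function.Surjective
          (fun ψ : M →ₗ[↥𝒜] ↥𝒜 => (ψ.comp f : M' →ₗ[↥𝒜] ↥𝒜)) := by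
  have hfg0 : ∀ x, g x = 0 → ∃ y, f y = x := fun x hx => by
    have : x ∈ LinearMap.range f := hfg ▸ (LinearMap.mem_ker.mpr hx)
    exact this
  have hgf : ∀ y, g (f y) = 0 := fun y => by
    have : f y ∈ LinearMap.ker g := hfg ▸ LinearMap.mem_range_self f y
    exact this
  refine ⟨?_, ?_, ?_⟩
  · intro φ₁ φ₂ h
    ext1 x
    obtain ⟨y, rfl⟩ := hg x
    exact LinearMap.congr_fun h y
  · intro ψ
    constructor
    · intro h
      have h0 : ∀ x, g x = 0 → ψ x = 0 := by
        intro x hx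
        obtain ⟨y, rfl⟩ := hfg0 x hx
        exact LinearMap.congr_fun h y
      choose r hr using hg
      have key : ∀ x y, g x = g y → ψ x = ψ y := fun x y hxy => by
        rw [← sub_eq_zero, ← map_sub]
        exact h0 _ (by rw [map_sub, hxy, sub_self])
      refine ⟨{ toFun := fun x => ψ (r x)
                map_add' := fun x y => by
                  rw [← map_add]; exact key _ _ (by simp only [map_add, hr])
                map_smul' := fun a x => by
                  rw [RingHom.id_apply, ← map_smul]
                  exact key _ _ (by simp only [map_smul, hr]) }, ?_⟩
      ext1 x
      exact key _ _ (hr _).symm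
    · rintro ⟨φ, rfl⟩
      ext1 y
      simp [hgf]
  · intro h
    obtain ⟨ι, ⟨hmul, hinv⟩, hloc⟩ := hLG
    have hone : ι 1 = 1 := by
      have := hmul (ι 1) 1
      rw [mul_one, hinv, mul_one] at this
      exact this.symm
    have : NoZeroSMulDivisors Λ ↥𝒜 := ⟨fun {c x} hcx => by
      by_cases hc : c = 0
      · exact Or.inl hc
      · right
        have h1 : c • (x : A) = 0 := congrArg Subtype.val hcx
        rw [← algebraMap_smul F c (x : A)] at h1
        have hc' : algebraMap Λ F c ≠ 0 := by
          rwa [Ne, map_eq_zero_iff _ (IsFractionRing.injective Λ F)]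
        exact Subtype.ext ((smul_eq_zero.mp h1).resolve_left hc')⟩
    have : Module.Projective Λ ↥𝒜 := aux_projective
    have : Module.Finite Λ M'' := Module.Finite.trans ↥𝒜 M''
    have : Module.Projective Λ M'' := aux_projective
    let I : Ideal Λ :=
      { carrier := {s | ∃ ψ : M →ₗ[↥𝒜] ↥𝒜, ∀ y, ψ (f y) = s • h y}
        zero_mem' := ⟨0, fun y => by simp⟩
        add_mem' := by
          rintro a b ⟨ψ, hψ⟩ ⟨ψ', hψ'⟩
          exact ⟨ψ + ψ', fun y => by rw [LinearMap.add_apply, hψ, hψ', add_smul]⟩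
        smul_mem' := by
          rintro c a ⟨ψ, hψ⟩
          exact ⟨c • ψ, fun y => by rw [LinearMap.smul_apply, hψ, smul_eq_mul, mul_smul]⟩ }
    suffices hI : I = ⊤ by
      have h1 : (1 : Λ) ∈ I := hI ▸ Submodule.mem_top
      obtain ⟨ψ, hψ⟩ := h1
      exact ⟨ψ, by ext1 y; exact (hψ y).trans (one_smul _ _)⟩
    by_contra hI
    obtain ⟨p, hp, hIp⟩ := Ideal.exists_le_maximal I hI
    have := hp.isPrime
    obtain ⟨θ, hθ⟩ := hloc p
    obtain ⟨hinj, t, htp, ht⟩ := aux_local p _ hθ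
    refine htp (hIp ?_)
    have hD : ∀ a x, dualActionMap Λ A 𝒜 ι θ a x = θ (ι a * x) := fun _ _ => rfl
    obtain ⟨L, hL⟩ := aux_extend (f.restrictScalars Λ) (g.restrictScalars Λ) hf hg hfg0 hgf
      (θ.comp (ι.comp (h.restrictScalars Λ)))
    have hL' : ∀ y, L (f y) = θ (ι (h y)) := hL
    let Φ : M → Module.Dual Λ ↥𝒜 := fun m =>
      { toFun := fun x => L (ι x • m)
        map_add' := fun x y => by rw [map_add, add_smul, map_add]
        map_smul' := fun c x => by
          rw [map_smul ι, smul_assoc, map_smul L, RingHom.id_apply] }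
    have hΦ : ∀ m x, Φ m x = L (ι x • m) := fun _ _ => rfl
    have hex : ∀ m, ∃ a, dualActionMap Λ A 𝒜 ι θ a = t • Φ m := fun m => ht _
    choose ψ hψ using hex
    have hψ' : ∀ m x, θ (ι (ψ m) * x) = t • L (ι x • m) := fun m x =>
      LinearMap.congr_fun (hψ m) x
    refine ⟨{ toFun := ψ, map_add' := ?_, map_smul' := ?_ }, ?_⟩
    · intro m m'
      apply hinj
      ext1 x
      rw [map_add, LinearMap.add_apply, hD, hD, hD, hψ', hψ', hψ', smul_add, map_add, smul_add]
    · intro a m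
      apply hinj
      ext1 x
      rw [RingHom.id_apply, hD, hD, hψ', smul_eq_mul a, hmul, mul_assoc, hψ', hmul, hinv,
        mul_smul]
    · intro y
      apply hinj
      ext1 x
      change dualActionMap Λ A 𝒜 ι θ (ψ (f y)) x = _
      rw [map_smul, LinearMap.smul_apply, hD, hD, hψ', ← map_smul f, hL', map_smul h,
        smul_eq_mul (ι x), hmul, hinv]


end
end

section
/- Let 𝒜 be a locally-Gorenstein Λ-order in A. Then the functor M ↦ Hom_𝒜(M, A/𝒜) is exact on the category of finitely generated Λ-torsion 𝒜-modules: for every short exact sequence 0 → M' → M → M'' → 0 of finitely generated Λ-torsion left 𝒜-modules, the induced sequence 0 → Hom_𝒜(M'', A/𝒜) → Hom_𝒜(M, A/𝒜) → Hom_𝒜(M', A/𝒜) → 0 is exact. Equivalently, Ext¹_𝒜(M, A/𝒜) = 0 for every finitely generated Λ-torsion 𝒜-module M. -/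
/-!
Statement 2.  Let `Λ` be a Dedekind domain with fraction field `F`, `A` a finite-dimensional
`F`-algebra and `𝒜` a locally-Gorenstein `Λ`-order in `A` (see Statement 0 for the encoding
of the locally-Gorenstein condition).  Then the functor `M ↦ Hom_𝒜(M, A/𝒜)` is exact on
finitely generated `Λ`-torsion `𝒜`-modules: for every short exact sequence
`0 → M' → M → M'' → 0` of such modules, the induced sequence
`0 → Hom_𝒜(M'', A/𝒜) → Hom_𝒜(M, A/𝒜) → Hom_𝒜(M', A/𝒜) → 0` is exact.
Here `A/𝒜` is the quotient of `A` by (the image of) `𝒜` as a left `𝒜`-module.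
-/

set_option linter.all false
set_option linter.overlappingInstances false
set_option linter.style.haveILetI false
set_option linter.unusedSectionVars false
set_option linter.unusedVariables false

noncomputable section

variable (Λ : Type) [CommRing Λ] [IsDomain Λ] [IsDedekindDomain Λ]
variable (F : Type) [Field F] [Algebra Λ F] [IsFractionRing Λ F]
variable (A : Type) [Ring A] [Algebra F A] [FiniteDimensional F A]
  [Algebra Λ A] [IsScalarTower Λ F A]
variable (𝒜 : Subalgebra Λ A)

/-- `𝒜`, viewed as an `𝒜`-submodule of `A`. -/
def orderSubmodule : Submodule ↥𝒜 A where
  carrier := 𝒜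
  add_mem' h1 h2 := add_mem h1 h2
  zero_mem' := zero_mem _
  smul_mem' c x hx := by
    show (c : A) * x ∈ 𝒜
    exact mul_mem c.2 hx

/-- `A/𝒜`, the quotient of `A` by `𝒜`, as a left `𝒜`-module. -/
def AModA : Type := A ⧸ orderSubmodule Λ A 𝒜

instance : AddCommGroup (AModA Λ A 𝒜) := by unfold AModA; infer_instance

instance : Module ↥𝒜 (AModA Λ A 𝒜) := by unfold AModA; infer_instance

section helpers

theorem aux_quot_baer : Module.Baer Λ (F ⧸ LinearMap.range (Algebra.linearMap Λ F)) := by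
  intro I g
  haveI : Module.IsTorsionFree Λ I := inferInstance
  haveI : Module.Finite Λ I := inferInstance
  haveI : Module.FinitePresentation Λ I := Module.finitePresentation_of_finite Λ I
  haveI : Module.Projective Λ I := Module.Flat.projective_of_finitePresentation
  obtain ⟨h, hh⟩ := Module.projective_lifting_property
    (LinearMap.range (Algebra.linearMap Λ F)).mkQ g (Submodule.mkQ_surjective _)
  have key : ∃ q : F, ∀ j : I, h j = algebraMap Λ F j * q := by
    by_cases hI : ∃ i : I, i ≠ 0
    · obtain ⟨i, hi⟩ := hI
      have hi' : algebraMap Λ F (i : Λ) ≠ 0 := by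
        intro h0
        apply hi
        apply Subtype.ext
        exact (FaithfulSMul.algebraMap_injective Λ F) (by simpa using h0)
      refine ⟨h i / algebraMap Λ F i, fun j => ?_⟩
      have e : (i : Λ) • j = (j : Λ) • i := by
        apply Subtype.ext
        simp [mul_comm]
      have e2 := congrArg h e
      rw [map_smul, map_smul, Algebra.smul_def, Algebra.smul_def] at e2
      field_simp
      rw [mul_comm]; exact e2
    · push Not at hI
      exact ⟨0, fun j => by rw [hI j]; simp⟩
  obtain ⟨q, hq⟩ := key
  refine ⟨(LinearMap.range (Algebra.linearMap Λ F)).mkQ.comp (LinearMap.toSpanSingleton Λ F q), ?_⟩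
  intro x hx
  have := LinearMap.congr_fun hh ⟨x, hx⟩
  rw [← this]
  simp [hq, Algebra.smul_def]

theorem aux_isLocalizedModule (hspan : Submodule.span F (𝒜 : Set A) = ⊤) :
    IsLocalizedModule (nonZeroDivisors Λ) 𝒜.val.toLinearMap := by
  refine ⟨fun r => ?_, fun a => ?_, fun {x y} h => ⟨1, ?_⟩⟩
  · have hr : algebraMap Λ F r ≠ 0 := by
      intro h0
      exact nonZeroDivisors.coe_ne_zero r ((FaithfulSMul.algebraMap_injective Λ F) (by simpa using h0))
    rw [Module.End.isUnit_iff]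
    constructor
    · intro x y hxy
      have : (algebraMap Λ F r) • x = (algebraMap Λ F r) • y := by
        simpa [Module.algebraMap_end_apply, algebraMap_smul] using hxy
      exact smul_right_injective A hr this
    · intro y
      refine ⟨(algebraMap Λ F r)⁻¹ • y, ?_⟩
      rw [Module.algebraMap_end_apply, ← algebraMap_smul F, smul_smul, mul_inv_cancel₀ hr, one_smul]
  · have ha : a ∈ Submodule.span F (𝒜 : Set A) := by rw [hspan]; trivial
    suffices h : ∃ s : nonZeroDivisors Λ, (s : Λ) • a ∈ 𝒜 by
      obtain ⟨s, hs⟩ := h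
      exact ⟨(⟨_, hs⟩, s), rfl⟩
    induction ha using Submodule.span_induction with
    | mem x hx => exact ⟨1, by simpa using hx⟩
    | zero => exact ⟨1, by simp⟩
    | add x y _ _ hx hy =>
      obtain ⟨s, hs⟩ := hx
      obtain ⟨t, ht⟩ := hy
      refine ⟨s * t, ?_⟩
      rw [smul_add]
      refine add_mem ?_ ?_
      · rw [Submonoid.coe_mul, mul_comm, mul_smul]
        exact 𝒜.smul_mem hs _
      · rw [Submonoid.coe_mul, mul_smul]
        exact 𝒜.smul_mem ht _
    | smul c x _ hx =>
      obtain ⟨s, hs⟩ := hx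
      obtain ⟨⟨n, d⟩, hd⟩ := IsLocalization.surj (nonZeroDivisors Λ) c
      refine ⟨s * d, ?_⟩
      have : ((s * d : nonZeroDivisors Λ) : Λ) • c • x = n • (s : Λ) • x := by
        rw [← algebraMap_smul F ((s * d : nonZeroDivisors Λ) : Λ), ← algebraMap_smul F n,
          ← algebraMap_smul F (s : Λ), smul_smul, smul_smul, ← hd]
        congr 1
        simp only [Submonoid.coe_mul, map_mul]
        ring
      rw [this]
      exact 𝒜.smul_mem hs _
  · rw [one_smul, one_smul]; exact Subtype.ext h

/-- every `Λ`-linear map `𝒜 → F` extends to an `F`-linear map on `A` -/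
theorem aux_extend_s2 (hspan : Submodule.span F (𝒜 : Set A) = ⊤) (h : ↥𝒜 →ₗ[Λ] F) :
    ∃ H : A →ₗ[F] F, ∀ x : ↥𝒜, H x = h x := by
  haveI := aux_isLocalizedModule Λ F A 𝒜 hspan
  have hu : ∀ x : nonZeroDivisors Λ, IsUnit ((algebraMap Λ (Module.End Λ F)) x) := by
    intro r
    have hr : algebraMap Λ F r ≠ 0 := by
      intro h0
      exact nonZeroDivisors.coe_ne_zero r ((FaithfulSMul.algebraMap_injective Λ F) (by simpa using h0))
    rw [Module.End.isUnit_iff]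
    constructor
    · intro x y hxy
      have : (algebraMap Λ F r) * x = (algebraMap Λ F r) * y := by
        simpa [Module.algebraMap_end_apply, Algebra.smul_def] using hxy
      exact mul_left_cancel₀ hr this
    · intro y
      refine ⟨(algebraMap Λ F r)⁻¹ * y, ?_⟩
      rw [Module.algebraMap_end_apply, Algebra.smul_def, mul_inv_cancel_left₀ hr]
  refine ⟨(IsLocalizedModule.lift (nonZeroDivisors Λ) 𝒜.val.toLinearMap h hu).extendScalarsOfIsLocalization
    (nonZeroDivisors Λ) F, fun x => ?_⟩
  exact IsLocalizedModule.lift_apply (nonZeroDivisors Λ) 𝒜.val.toLinearMap h hu x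

theorem aux_denom (hspan : Submodule.span F (𝒜 : Set A) = ⊤) (a : A) :
    ∃ s : Λ, s ≠ 0 ∧ s • a ∈ 𝒜 := by
  haveI := aux_isLocalizedModule Λ F A 𝒜 hspan
  obtain ⟨⟨x, s⟩, h⟩ := IsLocalizedModule.surj (nonZeroDivisors Λ) 𝒜.val.toLinearMap a
  refine ⟨s, nonZeroDivisors.coe_ne_zero s, ?_⟩
  have h' : (s : Λ) • a = (x : A) := h
  rw [h']; exact x.2

/-- if `T` is bijective locally at `p` -/
theorem aux_local_s2 {M N : Type} [AddCommGroup M] [AddCommGroup N] [Module Λ M] [Module Λ N]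
    [Module.Finite Λ N] [Module.IsTorsionFree Λ M]
    (p : Ideal Λ) [p.IsPrime] (T : M →ₗ[Λ] N)
    (hT : Function.Bijective (LocalizedModule.map p.primeCompl T)) :
    Function.Injective T ∧ ∃ s : Λ, s ∉ p ∧ ∀ n : N, ∃ m : M, T m = s • n := by
  constructor
  · rw [injective_iff_map_eq_zero]
    intro m hm
    have h1 : LocalizedModule.map p.primeCompl T (LocalizedModule.mk m 1) =
        LocalizedModule.map p.primeCompl T 0 := by
      rw [LocalizedModule.map_mk, hm, map_zero, LocalizedModule.zero_mk]
    have h2 := hT.1 h1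
    rw [← LocalizedModule.zero_mk 1, LocalizedModule.mk_eq] at h2
    obtain ⟨⟨c, hc⟩, hcm⟩ := h2
    simp only [Submonoid.smul_def, one_smul, smul_zero] at hcm
    have : c ≠ 0 := by rintro rfl; exact hc p.zero_mem
    exact (smul_eq_zero.mp hcm).resolve_left this
  · have h1 : ∀ n : N, ∃ s : Λ, s ∉ p ∧ ∃ m : M, T m = s • n := by
      intro n
      obtain ⟨y, hy⟩ := hT.2 (LocalizedModule.mk n 1)
      induction y using LocalizedModule.induction_on with
      | h m t =>
        rw [LocalizedModule.map_mk, LocalizedModule.mk_eq] at hy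
        obtain ⟨u, hu⟩ := hy
        simp only [Submonoid.smul_def, Submonoid.coe_one, one_smul] at hu
        refine ⟨(u : Λ) * t, (u * t).2, (u : Λ) • m, ?_⟩
        rw [map_smul, hu, mul_smul]
    obtain ⟨S, hS⟩ := (Module.Finite.fg_top : (⊤ : Submodule Λ N).FG)
    choose σ hσ hσ' using h1
    refine ⟨∏ n ∈ S, σ n, ?_, ?_⟩
    · intro hmem
      obtain ⟨n, _, hn⟩ := (Ideal.IsPrime.prod_mem_iff (p := p)).mp hmem
      exact hσ n hn
    · intro n
      have hn : n ∈ Submodule.span Λ (S : Set N) := by rw [hS]; trivial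
      induction hn using Submodule.span_induction with
      | mem x hx =>
        obtain ⟨m, hm⟩ := hσ' x
        obtain ⟨c, hc⟩ := Finset.dvd_prod_of_mem σ (Finset.mem_coe.mp hx)
        refine ⟨c • m, ?_⟩
        rw [map_smul, hm, hc, smul_smul, mul_comm]
      | zero => exact ⟨0, by simp⟩
      | add x y _ _ hx hy =>
        obtain ⟨m, hm⟩ := hx
        obtain ⟨m', hm'⟩ := hy
        exact ⟨m + m', by rw [map_add, hm, hm', smul_add]⟩
      | smul c x _ hx =>
        obtain ⟨m, hm⟩ := hx
        exact ⟨c • m, by rw [map_smul, hm, smul_comm]⟩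

theorem aux_torsionFree (_h : Submodule.span F (𝒜 : Set A) = ⊤) :
    Module.IsTorsionFree Λ ↥𝒜 := by
  rw [Module.isTorsionFree_iff_smul_eq_zero]
  intro r x h
  by_contra! hc
  have h2 : r • (x : A) = 0 := congrArg Subtype.val h
  rw [← algebraMap_smul F r (x : A)] at h2
  rcases smul_eq_zero.mp h2 with h3 | h3
  · exact hc.1 (FaithfulSMul.algebraMap_injective Λ F (by simpa using h3))
  · exact hc.2 (Subtype.ext h3)

theorem aux_theta [Module.Finite Λ ↥𝒜] (hspan : Submodule.span F (𝒜 : Set A) = ⊤)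
    (hLG : IsLocallyGorenstein Λ A 𝒜) (p : Ideal Λ) [p.IsPrime] :
    ∃ (θ : A →ₗ[F] F) (s : Λ), s ∉ p ∧
      (∀ x : ↥𝒜, ∃ l : Λ, algebraMap Λ F l = θ x) ∧
      (∀ a : A, (∀ x : ↥𝒜, ∃ l : Λ, algebraMap Λ F l = θ (x * a)) → s • a ∈ 𝒜) ∧
      (∀ h : ↥𝒜 →ₗ[Λ] F, ∃ a : A, ∀ x : ↥𝒜, θ (x * a) = h x) := by
  haveI := aux_torsionFree Λ F A 𝒜 hspan
  haveI : Module.FinitePresentation Λ ↥𝒜 := Module.finitePresentation_of_finite Λ _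
  haveI : Module.Projective Λ ↥𝒜 := Module.Flat.projective_of_finitePresentation
  have hinj := FaithfulSMul.algebraMap_injective Λ F
  obtain ⟨ι, ⟨hι1, hι2⟩, hp⟩ := hLG
  obtain ⟨θ₀, hθ₀⟩ := hp p
  obtain ⟨hT, s, hs, hsT⟩ := aux_local_s2 Λ p _ hθ₀
  have hTa : ∀ a x : ↥𝒜, dualActionMap Λ A 𝒜 ι θ₀ a x = θ₀ (ι a * x) := fun a x => rfl
  obtain ⟨θ, hθ⟩ := aux_extend_s2 Λ F A 𝒜 hspan ((Algebra.linearMap Λ F).comp (θ₀.comp ι))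
  have hθ' : ∀ x : ↥𝒜, θ x = algebraMap Λ F (θ₀ (ι x)) := hθ
  have hθΛ : ∀ (r : Λ) (a : A), θ (r • a) = algebraMap Λ F r * θ a := by
    intro r a
    rw [← algebraMap_smul F r a, map_smul, smul_eq_mul]
  have hθm : ∀ x a : ↥𝒜, θ ((x : A) * a) =
      algebraMap Λ F (dualActionMap Λ A 𝒜 ι θ₀ a (ι x)) := by
    intro x a
    have := hθ' (x * a)
    rw [hι1] at this
    exact this
  have hnd : ∀ a : A, (∀ x : ↥𝒜, θ (x * a) = 0) → a = 0 := by
    intro a ha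
    obtain ⟨r, hr, hra⟩ := aux_denom Λ F A 𝒜 hspan a
    have : (⟨r • a, hra⟩ : ↥𝒜) = 0 := by
      apply hT
      rw [map_zero]
      ext y
      apply hinj
      have := hθm (ι y) ⟨r • a, hra⟩
      rw [hι2] at this
      rw [← this]
      simp [hθΛ, ha]
    have h2 : r • a = 0 := congrArg Subtype.val this
    rw [← algebraMap_smul F r a] at h2
    refine (smul_eq_zero.mp h2).resolve_left ?_
    intro h0
    exact hr (hinj (by simpa using h0))
  refine ⟨θ, s, hs, fun x => ⟨_, (hθ' x).symm⟩, ?_, ?_⟩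
  · intro a ha
    choose d hd using ha
    let D : Module.Dual Λ ↥𝒜 :=
      { toFun := d
        map_add' := fun x y => by
          apply hinj
          rw [map_add, hd, hd, hd, ← map_add]
          congr 1
          simp [add_mul]
        map_smul' := fun r x => by
          apply hinj
          rw [smul_eq_mul, map_mul, RingHom.id_apply, hd, hd, ← hθΛ]
          congr 1
          simp }
    obtain ⟨b, hb⟩ := hsT (D.comp ι)
    have : s • a = b := by
      rw [← sub_eq_zero]
      apply hnd
      intro x
      rw [mul_sub, map_sub, hθm, hb]
      have e1 : (s • D.comp ι) (ι x) = s * d x := by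
        simp [D, hι2]
      rw [e1, mul_smul_comm, hθΛ, ← hd, ← (algebraMap Λ F).map_mul, sub_self]
    rw [this]; exact b.2
  · intro h
    obtain ⟨H, hH⟩ := aux_extend_s2 Λ F A 𝒜 hspan h
    let L : A →ₗ[F] Module.Dual F A :=
      (LinearMap.llcomp F A A F θ).comp (LinearMap.mul F A).flip
    have hL : ∀ a x, L a x = θ (x * a) := fun a x => rfl
    have hLi : Function.Injective L := by
      rw [injective_iff_map_eq_zero]
      intro a ha
      apply hnd
      intro x
      rw [← hL, ha]; rfl
    have hLs : Function.Surjective L :=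
      (LinearMap.injective_iff_surjective_of_finrank_eq_finrank
        (Subspace.dual_finrank_eq).symm).mp hLi
    obtain ⟨a, ha⟩ := hLs H
    exact ⟨a, fun x => by rw [← hL, ha, hH]⟩

/-- the quotient map -/
def aMk : A →ₗ[↥𝒜] AModA Λ A 𝒜 := (orderSubmodule Λ A 𝒜).mkQ

theorem aMk_surj : Function.Surjective (aMk Λ A 𝒜) := Submodule.mkQ_surjective _

theorem aMk_eq (a b : A) : aMk Λ A 𝒜 a = aMk Λ A 𝒜 b ↔ a - b ∈ 𝒜 :=
  Submodule.Quotient.eq (orderSubmodule Λ A 𝒜)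

theorem aux_step [Module.Finite Λ ↥𝒜] (hspan : Submodule.span F (𝒜 : Set A) = ⊤)
    (hLG : IsLocallyGorenstein Λ A 𝒜) (p : Ideal Λ) [p.IsPrime]
    (M' M : Type)
    [AddCommGroup M'] [Module ↥𝒜 M'] [Module Λ M'] [IsScalarTower Λ ↥𝒜 M']
    [AddCommGroup M] [Module ↥𝒜 M] [Module Λ M] [IsScalarTower Λ ↥𝒜 M]
    (f : M' →ₗ[↥𝒜] M) (hf : Function.Injective f) (φ : M' →ₗ[↥𝒜] AModA Λ A 𝒜) :
    ∃ s : Λ, s ∉ p ∧ ∃ ψ : M →ₗ[↥𝒜] AModA Λ A 𝒜,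
      ∀ m, ψ (f m) = algebraMap Λ ↥𝒜 s • φ m := by
  haveI := aux_torsionFree Λ F A 𝒜 hspan
  haveI : Module.FinitePresentation Λ ↥𝒜 := Module.finitePresentation_of_finite Λ _
  haveI : Module.Projective Λ ↥𝒜 := Module.Flat.projective_of_finitePresentation
  obtain ⟨θ, s, hs, h1, h2, h3⟩ := aux_theta Λ F A 𝒜 hspan hLG p
  refine ⟨s, hs, ?_⟩
  have hθΛ : ∀ (r : Λ) (a : A), θ (r • a) = algebraMap Λ F r * θ a := by
    intro r a
    rw [← algebraMap_smul F r a, map_smul, smul_eq_mul]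
  let N := LinearMap.range (Algebra.linearMap Λ F)
  let π : F →ₗ[Λ] F ⧸ N := N.mkQ
  have hπ : ∀ x y, π x = π y ↔ ∃ l : Λ, algebraMap Λ F l = x - y := by
    intro x y
    exact (Submodule.Quotient.eq N).trans Iff.rfl
  have hθw : ∀ a b, aMk Λ A 𝒜 a = aMk Λ A 𝒜 b → π (θ a) = π (θ b) := by
    intro a b hab
    rw [hπ, ← map_sub]
    exact h1 ⟨a - b, (aMk_eq Λ A 𝒜 a b).mp hab⟩
  choose rep hrep using fun m => aMk_surj Λ A 𝒜 (φ m)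
  let lam : M' →ₗ[Λ] F ⧸ N :=
    { toFun := fun m => π (θ (rep m))
      map_add' := fun m n => by
        rw [← map_add, ← map_add]
        apply hθw
        rw [map_add, hrep, hrep, hrep, map_add]
      map_smul' := fun r m => by
        rw [RingHom.id_apply, ← map_smul, Algebra.smul_def, ← hθΛ]
        apply hθw
        have : r • rep m = algebraMap Λ ↥𝒜 r • rep m := by
          rw [algebraMap_smul]
        rw [this, map_smul, hrep, hrep, ← map_smul, algebraMap_smul] }
  have hlam : ∀ m a, aMk Λ A 𝒜 a = φ m → lam m = π (θ a) := by
    intro m a h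
    exact hθw _ _ ((hrep m).trans h.symm)
  obtain ⟨μ, hμ⟩ := (aux_quot_baer Λ F).extension_property (f.restrictScalars Λ) hf lam
  have hμ' : ∀ m, μ (f m) = lam m := fun m => LinearMap.congr_fun hμ m
  have hex : ∀ m : M, ∃ a : A, ∀ x : ↥𝒜, π (θ (x * a)) = μ (x • m) := by
    intro m
    let k : ↥𝒜 →ₗ[Λ] F ⧸ N :=
      μ.comp ((LinearMap.toSpanSingleton ↥𝒜 M m).restrictScalars Λ)
    obtain ⟨h, hh⟩ := Module.projective_lifting_property π k (Submodule.mkQ_surjective _)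
    obtain ⟨a, ha⟩ := h3 h
    refine ⟨a, fun x => ?_⟩
    rw [ha]
    exact LinearMap.congr_fun hh x
  choose al hal using hex
  have huniq : ∀ a b : A, (∀ x : ↥𝒜, π (θ (x * a)) = π (θ (x * b))) →
      aMk Λ A 𝒜 (s • a) = aMk Λ A 𝒜 (s • b) := by
    intro a b hab
    rw [aMk_eq, ← smul_sub]
    apply h2
    intro x
    rw [mul_sub, map_sub]
    exact (hπ _ _).mp (hab x)
  refine ⟨{ toFun := fun m => aMk Λ A 𝒜 (s • al m), map_add' := ?_, map_smul' := ?_ }, ?_⟩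
  · intro m n
    rw [← map_add, ← smul_add]
    apply huniq
    intro x
    rw [mul_add, map_add, map_add, hal, hal, hal, smul_add, map_add]
  · intro y m
    rw [RingHom.id_apply, ← map_smul]
    have : y • s • al m = s • ((y : A) * al m) := by
      change (y : A) * (s • al m) = _
      rw [mul_smul_comm]
    rw [this]
    apply huniq
    intro x
    rw [hal, ← mul_assoc, smul_smul]
    exact (hal m (x * y)).symm
  · intro m
    have e : algebraMap Λ ↥𝒜 s • φ m = aMk Λ A 𝒜 (s • rep m) := by
      have : s • rep m = algebraMap Λ ↥𝒜 s • rep m := by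
        rw [algebraMap_smul]
      rw [this, map_smul, hrep]
    rw [e]
    apply huniq
    intro x
    rw [hal, ← map_smul, hμ']
    apply hlam
    have : (x : A) * rep m = x • rep m := rfl
    rw [this, map_smul, map_smul, hrep]

theorem aux_surj [Module.Finite Λ ↥𝒜] (hspan : Submodule.span F (𝒜 : Set A) = ⊤)
    (hLG : IsLocallyGorenstein Λ A 𝒜)
    (M' M : Type)
    [AddCommGroup M'] [Module ↥𝒜 M'] [Module Λ M'] [IsScalarTower Λ ↥𝒜 M']
    [AddCommGroup M] [Module ↥𝒜 M] [Module Λ M] [IsScalarTower Λ ↥𝒜 M]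
    (f : M' →ₗ[↥𝒜] M) (hf : Function.Injective f) (φ : M' →ₗ[↥𝒜] AModA Λ A 𝒜) :
    ∃ ψ : M →ₗ[↥𝒜] AModA Λ A 𝒜, ψ.comp f = φ := by
  let J : Ideal Λ :=
    { carrier := {s | ∃ ψ : M →ₗ[↥𝒜] AModA Λ A 𝒜, ∀ m, ψ (f m) = algebraMap Λ ↥𝒜 s • φ m}
      zero_mem' := ⟨0, fun m => by simp⟩
      add_mem' := by
        rintro s t ⟨ψ, h⟩ ⟨ψ', h'⟩
        exact ⟨ψ + ψ', fun m => by rw [LinearMap.add_apply, h, h', map_add, add_smul]⟩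
      smul_mem' := by
        rintro c s ⟨ψ, h⟩
        refine ⟨{ toFun := fun m => algebraMap Λ ↥𝒜 c • ψ m, map_add' := ?_, map_smul' := ?_ }, ?_⟩
        · intro x y; rw [map_add, smul_add]
        · intro y m
          rw [RingHom.id_apply, map_smul, smul_smul, smul_smul, Algebra.commutes]
        · intro m
          change algebraMap Λ ↥𝒜 c • ψ (f m) = _
          rw [h, smul_smul, smul_eq_mul, map_mul] }
  have hJ : J = ⊤ := by
    by_contra hne
    obtain ⟨p, hp, hJp⟩ := Ideal.exists_le_maximal J hne
    haveI := hp.isPrime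
    obtain ⟨s, hs, hψ⟩ := aux_step Λ F A 𝒜 hspan hLG p M' M f hf φ
    exact hs (hJp hψ)
  have h1 : (1 : Λ) ∈ J := by rw [hJ]; trivial
  obtain ⟨ψ, h⟩ := h1
  refine ⟨ψ, LinearMap.ext fun m => ?_⟩
  have := h m
  rw [map_one, one_smul] at this
  exact this

end helpers

/-- If `𝒜` is a locally-Gorenstein `Λ`-order, then `Hom_𝒜(-, A/𝒜)` is exact on finitely
generated `Λ`-torsion `𝒜`-modules. -/
theorem locallyGorenstein_hom_quotient_exact
    [Module.Finite Λ ↥𝒜] (hspan : Submodule.span F (𝒜 : Set A) = ⊤)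
    (hLG : IsLocallyGorenstein Λ A 𝒜)
    (M' M M'' : Type)
    [AddCommGroup M'] [Module ↥𝒜 M'] [Module Λ M'] [IsScalarTower Λ ↥𝒜 M']
    [Module.Finite ↥𝒜 M'] (htor' : Module.IsTorsion Λ M')
    [AddCommGroup M] [Module ↥𝒜 M] [Module Λ M] [IsScalarTower Λ ↥𝒜 M]
    [Module.Finite ↥𝒜 M] (htor : Module.IsTorsion Λ M)
    [AddCommGroup M''] [Module ↥𝒜 M''] [Module Λ M''] [IsScalarTower Λ ↥𝒜 M'']
    [Module.Finite ↥𝒜 M''] (htor'' : Module.IsTorsion Λ M'')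
    (f : M' →ₗ[↥𝒜] M) (g : M →ₗ[↥𝒜] M'')
    (hf : Function.Injective f) (hg : Function.Surjective g)
    (hfg : LinearMap.range f = LinearMap.ker g) :
    Function.Injective
        (fun φ : M'' →ₗ[↥𝒜] AModA Λ A 𝒜 => φ.comp g) ∧
      (∀ ψ : M →ₗ[↥𝒜] AModA Λ A 𝒜,
          ψ.comp f = 0 ↔ ∃ φ : M'' →ₗ[↥𝒜] AModA Λ A 𝒜, ψ = φ.comp g) ∧
        Function.Surjective
          (fun ψ : M →ₗ[↥𝒜] AModA Λ A 𝒜 => (ψ.comp f : M' →ₗ[↥𝒜] AModA Λ A 𝒜)) := by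
  refine ⟨?_, ?_, ?_⟩
  · intro φ φ' h
    exact (LinearMap.cancel_right hg).mp h
  · intro ψ
    constructor
    · intro h
      have hker : LinearMap.ker g ≤ LinearMap.ker ψ := by
        rw [← hfg]
        rintro _ ⟨m, rfl⟩
        exact LinearMap.congr_fun h m
      let e := g.quotKerEquivOfSurjective hg
      refine ⟨((LinearMap.ker g).liftQ ψ hker).comp e.symm.toLinearMap, ?_⟩
      ext m
      have : e.symm (g m) = (LinearMap.ker g).mkQ m := by
        rw [LinearEquiv.symm_apply_eq]; rfl
      change ψ m = (LinearMap.ker g).liftQ ψ hker (e.symm (g m))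
      rw [this]; rfl
    · rintro ⟨φ, rfl⟩
      ext m
      have : g (f m) = 0 := by
        rw [← LinearMap.mem_ker, ← hfg]; exact ⟨m, rfl⟩
      change φ (g (f m)) = 0
      rw [this, map_zero]
  · intro φ
    exact aux_surj Λ F A 𝒜 hspan hLG M' M f hf φ

end
end

section
/- Let V be an irreducible complex representation of G. Then dim_ℂ Hom_{ℂ[G]}(V, X) = Σ_{ω ∈ R} dim_ℂ V^{G_ω} − δ, where R is a set of representatives of the G-orbits of Ω, G_ω is the stabilizer of ω in G, V^{G_ω} is the subspace of G_ω-fixed vectors, and δ = 1 if V is the trivial representation and δ = 0 otherwise. In particular, for nontrivial V the dimension equals Σ_{ω ∈ R} dim_ℂ V^{G_ω}, and for the trivial representation it equals (number of G-orbits of Ω) − 1. -/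
/-!
Statement 8.  Let `G` be a finite group and `Ω` a nonempty finite `G`-set.  Let `ℂ[Ω]` be
the permutation representation of `G` on the free `ℂ`-vector space on `Ω` (realized as
`Ω → ℂ` since `Ω` is finite), let `aug : ℂ[Ω] → ℂ` be the `G`-equivariant linear map
taking each basis element to `1`, and let `X := ker aug`, a subrepresentation of `ℂ[Ω]`
(we encode `X` as a representation `(X, ρX)` together with an equivariant linear
embedding into `ℂ[Ω]` whose image is exactly `ker aug`).  Let `(V, ρV)` be an irreducible
complex representation of `G`.  Then
`dim_ℂ Hom_{ℂ[G]} (V, X) = Σ_{ω ∈ R} dim_ℂ V^{G_ω} − δ`,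
where `R` is a set of representatives of the `G`-orbits of `Ω`, `G_ω` is the stabilizer
of `ω`, and `δ = 1` if `V` is the trivial representation and `δ = 0` otherwise.  (We
state this in the subtraction-free form `dim Hom + δ = Σ_{ω ∈ R} dim V^{G_ω}`.)
-/

set_option linter.unusedSectionVars false

noncomputable section

variable (G : Type) [Group G] [Fintype G]
variable (Ω : Type) [Fintype Ω] [Nonempty Ω] [MulAction G Ω]
variable (V : Type) [AddCommGroup V] [Module ℂ V] (ρV : Representation ℂ G V)
variable (X : Type) [AddCommGroup X] [Module ℂ X] (ρX : Representation ℂ G X)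

/-- The permutation representation of `G` on `ℂ[Ω] = Ω → ℂ`. -/
def permRep : Representation ℂ G (Ω → ℂ) where
  toFun g :=
    { toFun := fun f ω => f (g⁻¹ • ω)
      map_add' := fun _ _ => rfl
      map_smul' := fun _ _ => rfl }
  map_one' := by ext f ω; simp
  map_mul' := by intro g h; ext f ω; simp [mul_smul, mul_inv_rev]

/-- The augmentation map `ℂ[Ω] → ℂ` sending each basis element to `1`,
i.e. `f ↦ Σ_ω f ω`. -/
def augMap : (Ω → ℂ) →ₗ[ℂ] ℂ := ∑ ω : Ω, LinearMap.proj ω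

/-- `(X, ρX)` realizes the kernel of the augmentation map as a subrepresentation of
`ℂ[Ω]`, via the equivariant embedding `ins`. -/
def IsAugmentationKernel (ins : X →ₗ[ℂ] (Ω → ℂ)) : Prop :=
  Function.Injective ins ∧ LinearMap.range ins = LinearMap.ker (augMap Ω) ∧
    ∀ g : G, ins.comp (ρX g) = (permRep G Ω g).comp ins

/-- The space `Hom_{ℂ[G]} (V, X)` of `G`-equivariant `ℂ`-linear maps `V → X`. -/
def equivariantHom : Submodule ℂ (V →ₗ[ℂ] X) :=
  ⨅ g : G,
    LinearMap.ker
      ((LinearMap.llcomp ℂ V X X) (ρX g) - LinearMap.lcomp ℂ X (ρV g))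

/-- The subspace `V^H` of vectors fixed by a subgroup `H` of `G`. -/
def fixedSubspace (H : Subgroup G) : Submodule ℂ V :=
  ⨅ g ∈ H, LinearMap.ker (ρV g - LinearMap.id)

theorem mem_equivariantHom (T : V →ₗ[ℂ] X) :
    T ∈ equivariantHom G V ρV X ρX ↔ ∀ g v, ρX g (T v) = T (ρV g v) := by
  simp [equivariantHom, Submodule.mem_iInf, sub_eq_zero, LinearMap.ext_iff]

theorem mem_fixedSubspace (H : Subgroup G) (v : V) :
    v ∈ fixedSubspace G V ρV H ↔ ∀ g ∈ H, ρV g v = v := by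
  simp [fixedSubspace, Submodule.mem_iInf, sub_eq_zero]

open Classical in
theorem avg_mem (H : Subgroup G) (v : V) :
    ∑ h : H, ρV h v ∈ fixedSubspace G V ρV H := by
  rw [mem_fixedSubspace]
  intro g hg
  rw [map_sum]
  refine Fintype.sum_equiv (Equiv.mulLeft (⟨g, hg⟩ : H)) _ _ fun h => ?_
  simp [map_mul]

theorem permRep_apply (g : G) (f : Ω → ℂ) (w : Ω) : permRep G Ω g f w = f (g⁻¹ • w) := rfl

theorem augMap_apply (f : Ω → ℂ) : augMap Ω f = ∑ w, f w := by
  simp [augMap]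

theorem aug_perm (g : G) (f : Ω → ℂ) : augMap Ω (permRep G Ω g f) = augMap Ω f := by
  simp only [augMap_apply, permRep_apply]
  exact Fintype.sum_equiv (MulAction.toPerm g⁻¹) _ _ fun _ => rfl

abbrev permHom : Submodule ℂ (V →ₗ[ℂ] (Ω → ℂ)) :=
  equivariantHom G V ρV (Ω → ℂ) (permRep G Ω)

/-- evaluation at orbit representatives -/
def evalMap : permHom G Ω V ρV →ₗ[ℂ]
    ((q : Quotient (MulAction.orbitRel G Ω)) →
      Module.Dual ℂ (fixedSubspace G V ρV (MulAction.stabilizer G q.out))) where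
  toFun F q := ((LinearMap.proj q.out).comp F.1).comp (Submodule.subtype _)
  map_add' _ _ := rfl
  map_smul' _ _ := rfl

theorem evalMap_apply (F : permHom G Ω V ρV) (q : Quotient (MulAction.orbitRel G Ω))
    (v : fixedSubspace G V ρV (MulAction.stabilizer G q.out)) :
    evalMap G Ω V ρV F q v = F.1 v.1 q.out := rfl

/-- augmentation -/
def augRes : permHom G Ω V ρV →ₗ[ℂ] Module.Dual ℂ (fixedSubspace G V ρV ⊤) where
  toFun F := ((augMap Ω).comp F.1).comp (Submodule.subtype _)
  map_add' _ _ := by ext; simp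
  map_smul' _ _ := by ext; simp

theorem augRes_apply (F : permHom G Ω V ρV) (v : fixedSubspace G V ρV ⊤) :
    augRes G Ω V ρV F v = augMap Ω (F.1 v.1) := rfl

open Classical in
theorem evalMap_injective : Function.Injective (evalMap G Ω V ρV) := by
  rw [injective_iff_map_eq_zero]
  intro F hF
  have hE := (mem_equivariantHom G V ρV _ _ F.1).1 F.2
  have h1 : ∀ (q : Quotient (MulAction.orbitRel G Ω)) v, F.1 v q.out = 0 := by
    intro q v
    have h := evalMap_apply G Ω V ρV F q ⟨_, avg_mem G V ρV _ v⟩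
    rw [hF] at h
    simp only [map_sum, ← hE, Finset.sum_apply, permRep_apply] at h
    have h2 : ∀ x : MulAction.stabilizer G q.out, (x : G)⁻¹ • q.out = q.out := fun x =>
      (x⁻¹).2
    simp only [h2, Finset.sum_const, Finset.card_univ, nsmul_eq_mul] at h
    have h3 := h.symm
    simp only [Pi.zero_apply, LinearMap.zero_apply, mul_eq_zero, Nat.cast_eq_zero] at h3
    exact h3.resolve_left Fintype.card_ne_zero
  ext v w
  have hw : (MulAction.orbitRel G Ω) (Quotient.mk _ w : Quotient (MulAction.orbitRel G Ω)).out w :=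
    Quotient.exact (Quotient.out_eq _)
  obtain ⟨g, hg⟩ := hw
  have h4 := congrFun (hE g v) (Quotient.mk _ w : Quotient (MulAction.orbitRel G Ω)).out
  rw [h1, permRep_apply, ← hg, inv_smul_smul] at h4
  exact h4

open Classical in
theorem evalMap_surjective : Function.Surjective (evalMap G Ω V ρV) := by
  intro φ
  choose ψ hψ using fun q => LinearMap.exists_extend (φ q)
  let F : V →ₗ[ℂ] (Ω → ℂ) := LinearMap.pi fun w =>
    ∑ q : Quotient (MulAction.orbitRel G Ω), ∑ g : G, if g • q.out = w then
      ((Fintype.card (MulAction.stabilizer G q.out) : ℂ)⁻¹) • (ψ q).comp (ρV g⁻¹) else 0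
  have hFa : ∀ v w, F v w = ∑ q : Quotient (MulAction.orbitRel G Ω), ∑ g : G,
      if g • q.out = w then
      ((Fintype.card (MulAction.stabilizer G q.out) : ℂ)⁻¹) * ψ q (ρV g⁻¹ v) else 0 := by
    intro v w
    simp only [F, LinearMap.pi_apply, LinearMap.sum_apply]
    refine Finset.sum_congr rfl fun q _ => Finset.sum_congr rfl fun g _ => ?_
    split_ifs <;> simp
  have hF : F ∈ permHom G Ω V ρV := by
    rw [mem_equivariantHom]
    intro k v
    ext w
    rw [permRep_apply, hFa, hFa]
    refine Finset.sum_congr rfl fun q _ => ?_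
    refine Fintype.sum_equiv (Equiv.mulLeft k) _ _ fun g => ?_
    have : (k * g) • q.out = w ↔ g • q.out = k⁻¹ • w := by
      rw [mul_smul, eq_inv_smul_iff]
    simp only [Equiv.coe_mulLeft, this, ← Module.End.mul_apply, ← map_mul, mul_inv_rev,
      inv_mul_cancel_right]
  refine ⟨⟨F, hF⟩, ?_⟩
  ext q v
  rw [evalMap_apply, hFa, Finset.sum_eq_single q]
  · have h1 : ∀ g : G, (if g • q.out = q.out then
        ((Fintype.card (MulAction.stabilizer G q.out) : ℂ)⁻¹) * ψ q (ρV g⁻¹ v) else 0) =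
        if g ∈ MulAction.stabilizer G q.out then
        ((Fintype.card (MulAction.stabilizer G q.out) : ℂ)⁻¹) * φ q v else 0 := by
      intro g
      simp only [MulAction.mem_stabilizer_iff]
      split_ifs with h
      · rw [(mem_fixedSubspace G V ρV _ _).1 v.2 g⁻¹ (inv_mem h), ← hψ]; rfl
      · rfl
    rw [Finset.sum_congr rfl fun g _ => h1 g, ← Finset.sum_filter, Finset.sum_const,
      nsmul_eq_mul, ← Fintype.card_subtype, ← mul_assoc]
    have : (Fintype.card (MulAction.stabilizer G q.out) : ℂ) ≠ 0 :=
      Nat.cast_ne_zero.2 Fintype.card_ne_zero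
    convert one_mul _
    convert mul_inv_cancel₀ this
  · intro q' _ hq
    refine Finset.sum_eq_zero fun g _ => if_neg fun h => hq ?_
    rw [← Quotient.out_eq q', ← Quotient.out_eq q]
    exact (Quotient.sound (show (MulAction.orbitRel G Ω) q.out q'.out from ⟨g, h⟩)).symm
  · simp

theorem augRes_surjective : Function.Surjective (augRes G Ω V ρV) := by
  intro φ
  obtain ⟨ψ, hψ⟩ := LinearMap.exists_extend φ
  let c : ℂ := (Fintype.card Ω : ℂ)⁻¹ * (Fintype.card G : ℂ)⁻¹
  let F : V →ₗ[ℂ] (Ω → ℂ) := LinearMap.pi fun w => c • ∑ g : G, ψ.comp (ρV g)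
  have hFa : ∀ v w, F v w = c * ∑ g : G, ψ (ρV g v) := by
    intro v w
    simp [F, LinearMap.sum_apply]
  have hF : F ∈ permHom G Ω V ρV := by
    rw [mem_equivariantHom]
    intro k v
    ext w
    rw [permRep_apply, hFa, hFa]
    congr 1
    refine (Fintype.sum_equiv (Equiv.mulRight k) _ _ fun g => ?_).symm
    simp [map_mul]
  refine ⟨⟨F, hF⟩, ?_⟩
  ext v
  have hv : ∀ g, ρV g v = v := fun g => (mem_fixedSubspace G V ρV _ _).1 v.2 g trivial
  have h1 : φ v = ψ v := by rw [← hψ]; rfl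
  have h2 : (Fintype.card Ω : ℂ) ≠ 0 := Nat.cast_ne_zero.2 Fintype.card_ne_zero
  have h3 : (Fintype.card G : ℂ) ≠ 0 := Nat.cast_ne_zero.2 Fintype.card_ne_zero
  rw [augRes_apply, augMap_apply, h1]
  simp only [hFa, hv, Finset.sum_const, Finset.card_univ, nsmul_eq_mul, c]
  field_simp

theorem mem_ker_augRes (F : permHom G Ω V ρV) :
    F ∈ LinearMap.ker (augRes G Ω V ρV) ↔ ∀ v, augMap Ω (F.1 v) = 0 := by
  classical
  have hE := (mem_equivariantHom G V ρV _ _ F.1).1 F.2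
  rw [LinearMap.mem_ker]
  constructor
  · intro h v
    have h1 := augRes_apply G Ω V ρV F ⟨_, avg_mem G V ρV _ v⟩
    rw [h] at h1
    simp only [map_sum, ← hE, aug_perm, Finset.sum_const, Finset.card_univ, nsmul_eq_mul] at h1
    have h3 := h1.symm
    simp only [LinearMap.zero_apply, mul_eq_zero, Nat.cast_eq_zero] at h3
    exact h3.resolve_left Fintype.card_ne_zero
  · intro h
    ext v
    exact h v

theorem finite_of_irr
    (hirr : ∀ W : Submodule ℂ V, (∀ g : G, W.map (ρV g) ≤ W) → W = ⊥ ∨ W = ⊤)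
    (hnt : Nontrivial V) : FiniteDimensional ℂ V := by
  obtain ⟨v, hv⟩ := exists_ne (0 : V)
  rcases hirr (Submodule.span ℂ (Set.range fun g : G => ρV g v)) (fun g => by
    rw [Submodule.map_span, Submodule.span_le]
    rintro _ ⟨_, ⟨h, rfl⟩, rfl⟩
    refine Submodule.subset_span ⟨g * h, ?_⟩
    simp [map_mul]) with h | h
  · rw [Submodule.span_eq_bot] at h
    exact absurd (h v ⟨1, by simp⟩) hv
  · exact ⟨h ▸ Submodule.fg_span (Set.finite_range _)⟩

open Classical in
theorem finrank_fixed_top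
    (hirr : ∀ W : Submodule ℂ V, (∀ g : G, W.map (ρV g) ≤ W) → W = ⊥ ∨ W = ⊤)
    (hnt : Nontrivial V) : Module.finrank ℂ (fixedSubspace G V ρV ⊤) =
      if ∀ g : G, ρV g = LinearMap.id then 1 else 0 := by
  split_ifs with h
  · have h1 : fixedSubspace G V ρV ⊤ = ⊤ := by
      rw [eq_top_iff]; intro v _
      rw [mem_fixedSubspace]; intro g _; rw [h]; rfl
    rw [h1, finrank_top]
    obtain ⟨v, hv⟩ := exists_ne (0 : V)
    rcases hirr (ℂ ∙ v) (fun g => by rw [h]; simp) with h2 | h2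
    · rw [Submodule.span_singleton_eq_bot] at h2; exact absurd h2 hv
    · rw [← finrank_top, ← h2, finrank_span_singleton hv]
  · rcases hirr (fixedSubspace G V ρV ⊤) (fun g => by
      rintro _ ⟨v, hv, rfl⟩
      rwa [(mem_fixedSubspace G V ρV _ _).1 hv g trivial]) with h2 | h2
    · rw [h2, finrank_bot]
    · refine absurd (fun g => ?_) h
      ext v
      exact (mem_fixedSubspace G V ρV ⊤ v).1 (h2 ▸ trivial) g trivial

open Classical in
/-- For an irreducible complex representation `V` of `G`:
`dim Hom_{ℂ[G]}(V, X) + δ = Σ_{ω ∈ R} dim V^{G_ω}`, where `X` is the kernel of the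
augmentation map of the permutation representation on `Ω`, `R` is a set of
representatives of the `G`-orbits of `Ω` and `δ = 1` iff `V` is trivial. -/
theorem finrank_equivariantHom_augKer
    (hirr : ∀ W : Submodule ℂ V, (∀ g : G, W.map (ρV g) ≤ W) → W = ⊥ ∨ W = ⊤)
    (hnt : Nontrivial V)
    (ins : X →ₗ[ℂ] (Ω → ℂ)) (hX : IsAugmentationKernel G Ω X ρX ins) :
    Module.finrank ℂ ↥(equivariantHom G V ρV X ρX) +
        (if ∀ g : G, ρV g = LinearMap.id then 1 else 0) =
      ∑ q : Quotient (MulAction.orbitRel G Ω),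
        Module.finrank ℂ
          ↥(fixedSubspace G V ρV (MulAction.stabilizer G q.out)) := by
  obtain ⟨hinj, hrange, hcomm⟩ := hX
  have hcomm' : ∀ g x, ins (ρX g x) = permRep G Ω g (ins x) := fun g x =>
    LinearMap.congr_fun (hcomm g) x
  have := finite_of_irr G V ρV hirr hnt
  let C : equivariantHom G V ρV X ρX →ₗ[ℂ] permHom G Ω V ρV :=
    { toFun := fun T => ⟨ins.comp T.1, by
        rw [mem_equivariantHom]
        intro g v
        have := (mem_equivariantHom G V ρV _ _ T.1).1 T.2 g v
        simp [← hcomm', this]⟩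
      map_add' := fun _ _ => by ext; simp
      map_smul' := fun _ _ => by ext; simp }
  have hC : ∀ T v, (C T).1 v = ins (T.1 v) := fun _ _ => rfl
  have hCinj : Function.Injective C := by
    intro S T h
    ext v
    apply hinj
    rw [← hC, ← hC, h]
  have hCr : LinearMap.range C = LinearMap.ker (augRes G Ω V ρV) := by
    ext F
    rw [mem_ker_augRes]
    constructor
    · rintro ⟨T, rfl⟩ v
      have : ins (T.1 v) ∈ LinearMap.ker (augMap Ω) := hrange ▸ LinearMap.mem_range_self _ _
      exact this
    · intro h
      have hE := (mem_equivariantHom G V ρV _ _ F.1).1 F.2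
      let e := LinearEquiv.ofInjective ins hinj
      let T : V →ₗ[ℂ] X := e.symm.toLinearMap.comp
        (F.1.codRestrict (LinearMap.range ins) fun v => by rw [hrange]; exact h v)
      have hT : ∀ v, ins (T v) = F.1 v := by
        intro v
        have : ((e (T v) : LinearMap.range ins) : Ω → ℂ) = F.1 v := by
          simp [T]
        exact this
      refine ⟨⟨T, ?_⟩, ?_⟩
      · rw [mem_equivariantHom]
        intro g v
        apply hinj
        rw [hcomm', hT, hT, hE]
      · apply Subtype.ext
        apply LinearMap.ext
        intro v
        exact hT v
  have h1 := LinearMap.finrank_range_add_finrank_ker (K := ℂ) (V := permHom G Ω V ρV)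
    (V₂ := Module.Dual ℂ (fixedSubspace G V ρV ⊤)) (augRes G Ω V ρV)
  rw [LinearMap.range_eq_top.2 (augRes_surjective G Ω V ρV), finrank_top,
    Subspace.dual_finrank_eq, finrank_fixed_top G V ρV hirr hnt, ← hCr,
    LinearMap.finrank_range_of_inj hCinj] at h1
  rw [add_comm, h1, (LinearEquiv.ofBijective (evalMap G Ω V ρV)
    ⟨evalMap_injective G Ω V ρV, evalMap_surjective G Ω V ρV⟩).finrank_eq,
    Module.finrank_pi_fintype]
  exact Finset.sum_congr rfl fun q _ => Subspace.dual_finrank_eq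

end
end
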